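/- Every f = (f_k) in the unit ball of H¹(ℓ_{4/3}) admits a factorization f_k = g_k·h_k (for every k, almost everywhere on 𝕋) where g = (g_k) lies in the unit ball of H²(ℓ₂) and h = (h_k) lies in the unit ball of H²(ℓ₄). -/

import Mathlib

open MeasureTheory Real ENNReal NNReal

noncomputable section

instance : Fact (0 < 2 * Real.pi) := ⟨by positivity⟩

/-- The circle group `𝕋`, realized as `ℝ / 2πℤ`. -/
abbrev 𝕋 : Type := AddCircle (2 * Real.pi)

/-- The normalized Haar measure on `𝕋`. -/
abbrev μ𝕋 : Measure 𝕋 := AddCircle.haarAddCircle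

/-- The mixed norm `‖f‖_{L^p(ℓ_q)} = (∫ (∑_k |f_k|^q)^{p/q} dm)^{1/p}` of a sequence
`f = (f_k)` of functions on `𝕋`, valued in `ℝ≥0∞`. -/
def eLpLqNorm (p q : ℝ) (f : ℕ → 𝕋 → ℂ) : ℝ≥0∞ :=
  (∫⁻ t, ((∑' k, (‖f k t‖₊ : ℝ≥0∞) ^ q) ^ (1 / q)) ^ p ∂μ𝕋) ^ (1 / p)

/-- `f = (f_k)` belongs to `L^p(ℓ_q)`. -/
def MemLpLq (p q : ℝ) (f : ℕ → 𝕋 → ℂ) : Prop :=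
  (∀ k, AEStronglyMeasurable (f k) μ𝕋) ∧ eLpLqNorm p q f < ⊤

/-- `f = (f_k)` belongs to `H^p(ℓ_q)`: it belongs to `L^p(ℓ_q)` and every Fourier
coefficient `f̂_k(n)` with `n < 0` vanishes. -/
def MemHpLq (p q : ℝ) (f : ℕ → 𝕋 → ℂ) : Prop :=
  MemLpLq p q f ∧ ∀ k, ∀ n : ℤ, n < 0 → fourierCoeff (f k) n = 0

/-- The K-functional `K_t(f; X₀, X₁)` for a couple of spaces of sequences of functions given
by membership predicates `X₀, X₁` and (quasi-)norms `N₀, N₁`: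
`inf {N₀(g₀) + t N₁(g₁) : f = g₀ + g₁, g₀ ∈ X₀, g₁ ∈ X₁}`. -/
def Kfunctional (t : ℝ≥0∞) (X₀ X₁ : (ℕ → 𝕋 → ℂ) → Prop)
    (N₀ N₁ : (ℕ → 𝕋 → ℂ) → ℝ≥0∞) (f : ℕ → 𝕋 → ℂ) : ℝ≥0∞ :=
  ⨅ (g₀ : ℕ → 𝕋 → ℂ) (g₁ : ℕ → 𝕋 → ℂ) (_ : X₀ g₀) (_ : X₁ g₁) (_ : f = g₀ + g₁),
    N₀ g₀ + t * N₁ g₁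

open scoped Topology ComplexConjugate
open Filter

section Fejer

variable {E : Type*} [NormedAddCommGroup E] [NormedSpace ℂ E]

/-- The Fejér kernel of order `M`. -/
def fejerKernel (M : ℕ) (t : 𝕋) : ℝ :=
  ‖∑ j ∈ Finset.range (M + 1), fourier (j : ℤ) t‖ ^ 2 / (M + 1)

/-- The Fejér mean of order `M` of a vector-valued function, as a trigonometric polynomial. -/
def fejerMean (M : ℕ) (F : 𝕋 → E) (t : 𝕋) : E :=
  (M + 1 : ℂ)⁻¹ • ∑ i ∈ Finset.range (M + 1), ∑ j ∈ Finset.range (M + 1),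
    fourier ((i : ℤ) - j) t • fourierCoeff F ((i : ℤ) - j)

lemma fejerKernel_nonneg (M : ℕ) (t : 𝕋) : 0 ≤ fejerKernel M t := by
  unfold fejerKernel; positivity

lemma continuous_fejerKernel (M : ℕ) : Continuous (fejerKernel M) := by
  unfold fejerKernel
  refine Continuous.div_const (Continuous.pow (Continuous.norm ?_) 2) _
  exact continuous_finsetSum _ fun j _ => (fourier (j : ℤ)).continuous

lemma fourier_sub_index (i j : ℤ) (t : 𝕋) :
    fourier (i - j) t = fourier i t * conj (fourier j t) := by
  rw [sub_eq_add_neg, fourier_add, fourier_neg]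

lemma fourier_sub_arg (n : ℤ) (s t : 𝕋) :
    fourier n (t - s) = fourier n t * fourier (-n) s := by
  rw [fourier_apply, fourier_apply, fourier_apply, smul_sub, sub_eq_add_neg,
    AddCircle.toCircle_add, Circle.coe_mul, neg_smul]

lemma ofReal_fejerKernel (M : ℕ) (t : 𝕋) :
    (fejerKernel M t : ℂ) = (M + 1 : ℂ)⁻¹ * ∑ i ∈ Finset.range (M + 1),
      ∑ j ∈ Finset.range (M + 1), fourier ((i : ℤ) - j) t := by
  have : ∀ i j : ℕ, fourier ((i : ℤ) - j) t = fourier (i : ℤ) t * conj (fourier (j : ℤ) t) :=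
    fun i j => fourier_sub_index _ _ _
  simp_rw [this, ← Finset.mul_sum, ← Finset.sum_mul, ← map_sum, Complex.mul_conj, fejerKernel,
    Complex.normSq_eq_norm_sq]
  push_cast
  ring

lemma integral_fourier (n : ℤ) : ∫ t : 𝕋, fourier n t ∂μ𝕋 = if n = 0 then 1 else 0 := by
  have := fourierCoeff_fourier (T := 2 * Real.pi) n
  have h0 := congrFun this 0
  simp only [fourierCoeff, neg_zero, fourier_zero, one_smul] at h0
  rw [h0, Pi.single_apply]
  simp only [eq_comm]

lemma integrable_fourier (n : ℤ) : Integrable (fun t : 𝕋 => fourier n t) μ𝕋 :=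
  (fourier n).continuous.integrable_of_hasCompactSupport (HasCompactSupport.of_compactSpace _)

lemma integral_fejerKernel (M : ℕ) : ∫ t : 𝕋, fejerKernel M t ∂μ𝕋 = 1 := by
  have h : ∫ t : 𝕋, (fejerKernel M t : ℂ) ∂μ𝕋 = 1 := by
    simp_rw [ofReal_fejerKernel]
    rw [integral_const_mul, integral_finsetSum _ fun i _ => integrable_finsetSum _
      fun j _ => integrable_fourier _]
    simp_rw [fun i : ℕ => integral_finsetSum (μ := μ𝕋) (Finset.range (M + 1))
      (f := fun j t => fourier ((i : ℤ) - j) t) fun j _ => integrable_fourier _,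
      integral_fourier, sub_eq_zero, Nat.cast_inj]
    simp only [Finset.sum_ite_eq, Finset.mem_range]
    rw [Finset.sum_congr rfl fun i hi => if_pos (Finset.mem_range.1 hi)]
    simp only [Finset.sum_const, Finset.card_range, nsmul_eq_mul, mul_one, Nat.cast_add,
      Nat.cast_one]
    exact inv_mul_cancel₀ (Nat.cast_add_one_ne_zero M)
  rw [integral_complex_ofReal] at h
  exact Complex.ofReal_injective h

lemma lintegral_fejerKernel (M : ℕ) :
    ∫⁻ t : 𝕋, ENNReal.ofReal (fejerKernel M t) ∂μ𝕋 = 1 := by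
  rw [← ofReal_integral_eq_lintegral_ofReal, integral_fejerKernel, ENNReal.ofReal_one]
  · exact (continuous_fejerKernel M).integrable_of_hasCompactSupport
      (HasCompactSupport.of_compactSpace _)
  · exact ae_of_all _ (fejerKernel_nonneg M)

lemma fejerMean_eq_integral (M : ℕ) {F : 𝕋 → E} (hF : Integrable F μ𝕋) (t : 𝕋) :
    fejerMean M F t = ∫ s, (fejerKernel M (t - s) : ℂ) • F s ∂μ𝕋 := by
  have hi : ∀ n : ℤ, Integrable (fun s => fourier n (t - s) • F s) μ𝕋 := fun n => by
    simp_rw [fourier_sub_arg, mul_smul]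
    exact Integrable.smul (fourier n t : ℂ) (hF.fourier_smul (-n))
  simp_rw [ofReal_fejerKernel, mul_smul, Finset.sum_smul]
  rw [integral_smul, integral_finsetSum _ fun i _ => integrable_finsetSum _ fun j _ => hi _,
    fejerMean]
  congr 1
  refine Finset.sum_congr rfl fun i _ => ?_
  rw [integral_finsetSum _ fun j _ => hi _]
  refine Finset.sum_congr rfl fun j _ => ?_
  simp_rw [fourier_sub_arg, mul_smul]
  rw [integral_smul, fourierCoeff]

lemma enorm_fejerMean_rpow_le (M : ℕ) {p : ℝ} (hp : 1 ≤ p) {F : 𝕋 → E} (hF : Integrable F μ𝕋)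
    (t : 𝕋) : ‖fejerMean M F t‖ₑ ^ p ≤
      ∫⁻ s, ENNReal.ofReal (fejerKernel M (t - s)) * ‖F s‖ₑ ^ p ∂μ𝕋 := by
  have hKm : Measurable fun s => ENNReal.ofReal (fejerKernel M (t - s)) :=
    ((continuous_fejerKernel M).comp (continuous_const.sub continuous_id)).measurable.ennreal_ofReal
  set ν : Measure 𝕋 := μ𝕋.withDensity fun s => ENNReal.ofReal (fejerKernel M (t - s)) with hν
  have : IsProbabilityMeasure ν := ⟨by
    rw [withDensity_apply _ MeasurableSet.univ, Measure.restrict_univ,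
      lintegral_sub_left_eq_self (fun s => ENNReal.ofReal (fejerKernel M s)) t,
      lintegral_fejerKernel]⟩
  have hFν : AEStronglyMeasurable F ν := hF.1.mono_ac (withDensity_absolutelyContinuous _ _)
  have hp0 : 0 < p := by linarith
  have hlt : ∀ᵐ s ∂μ𝕋, ENNReal.ofReal (fejerKernel M (t - s)) < ⊤ :=
    ae_of_all _ fun _ => ENNReal.ofReal_lt_top
  have h1 : ‖fejerMean M F t‖ₑ ≤ ∫⁻ s, ‖F s‖ₑ ∂ν := by
    rw [fejerMean_eq_integral M hF, lintegral_withDensity_eq_lintegral_mul_non_measurable _ hKm hlt]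
    refine (enorm_integral_le_lintegral_enorm _).trans (lintegral_mono fun s => ?_)
    simp only [enorm_smul, Pi.mul_apply]
    gcongr
    rw [← ofReal_norm, Complex.norm_real, Real.norm_of_nonneg (fejerKernel_nonneg _ _)]
  have h2 := eLpNorm'_le_eLpNorm'_of_exponent_le zero_lt_one hp ν hFν
  simp only [eLpNorm', ENNReal.rpow_one, one_div, inv_one] at h2
  have h3 := ENNReal.rpow_le_rpow (h1.trans h2) hp0.le
  rw [← ENNReal.rpow_mul, inv_mul_cancel₀ hp0.ne', ENNReal.rpow_one,
    lintegral_withDensity_eq_lintegral_mul_non_measurable _ hKm hlt] at h3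
  exact h3

/-- Fejér means are contractive in `L^p`. -/
lemma eLpNorm_fejerMean_le (M : ℕ) {p : ℝ≥0∞} (hp : 1 ≤ p) (hp' : p ≠ ⊤) {F : 𝕋 → E}
    (hF : Integrable F μ𝕋) : eLpNorm (fejerMean M F) p μ𝕋 ≤ eLpNorm F p μ𝕋 := by
  have hp0 : p ≠ 0 := (zero_lt_one.trans_le hp).ne'
  have hpr : 1 ≤ p.toReal := by simpa using ENNReal.toReal_mono hp' hp
  rw [eLpNorm_eq_lintegral_rpow_enorm_toReal hp0 hp', eLpNorm_eq_lintegral_rpow_enorm_toReal hp0 hp']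
  refine ENNReal.rpow_le_rpow ?_ (by positivity)
  calc ∫⁻ t, ‖fejerMean M F t‖ₑ ^ p.toReal ∂μ𝕋
      ≤ ∫⁻ t, ∫⁻ s, ENNReal.ofReal (fejerKernel M (t - s)) * ‖F s‖ₑ ^ p.toReal ∂μ𝕋 ∂μ𝕋 :=
        lintegral_mono fun t => enorm_fejerMean_rpow_le M hpr hF t
    _ = ∫⁻ s, ∫⁻ t, ENNReal.ofReal (fejerKernel M (t - s)) * ‖F s‖ₑ ^ p.toReal ∂μ𝕋 ∂μ𝕋 := by
        refine lintegral_lintegral_swap (AEMeasurable.mul ?_ ?_)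
        · exact ((continuous_fejerKernel M).comp
            (continuous_fst.sub continuous_snd)).measurable.ennreal_ofReal.aemeasurable
        · exact (hF.1.enorm.pow_const _).comp_snd
    _ = ∫⁻ s, ‖F s‖ₑ ^ p.toReal ∂μ𝕋 := by
        refine lintegral_congr fun s => ?_
        rw [lintegral_mul_const' _ _ (by finiteness),
          lintegral_sub_right_eq_self (fun t => ENNReal.ofReal (fejerKernel M t)) s,
          lintegral_fejerKernel, one_mul]

end Fejer

section FejerConvergence

variable {E : Type*} [NormedAddCommGroup E] [NormedSpace ℂ E]

lemma fejerMean_congr_ae (M : ℕ) {F G : 𝕋 → E} (h : F =ᵐ[μ𝕋] G) :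
    fejerMean M F = fejerMean M G := by
  have : fourierCoeff F = fourierCoeff G := fourierCoeff_congr_ae h
  ext t
  simp only [fejerMean, this]

lemma fejerMean_add (M : ℕ) {F G : 𝕋 → E} (hF : Integrable F μ𝕋) (hG : Integrable G μ𝕋) :
    fejerMean M (F + G) = fejerMean M F + fejerMean M G := by
  have : fourierCoeff (F + G) = fourierCoeff F + fourierCoeff G := fourierCoeff.add hF hG
  ext t
  simp only [fejerMean, this, Pi.add_apply, smul_add, Finset.sum_add_distrib]

lemma fejerMean_const_smul (M : ℕ) (c : ℂ) (F : 𝕋 → E) :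
    fejerMean M (c • F) = c • fejerMean M F := by
  have : fourierCoeff (c • F) = c • fourierCoeff F := funext (fourierCoeff.const_smul F c)
  ext t
  simp only [fejerMean, this, Pi.smul_apply, Finset.smul_sum]
  simp only [smul_comm _ c]

lemma fejerMean_sub (M : ℕ) {F G : 𝕋 → E} (hF : Integrable F μ𝕋) (hG : Integrable G μ𝕋) :
    fejerMean M (F - G) = fejerMean M F - fejerMean M G := by
  have h := fejerMean_add M hF (hG.smul (-1 : ℂ))
  rw [fejerMean_const_smul] at h
  simpa [sub_eq_add_neg] using h

lemma continuous_fejerMean (M : ℕ) (F : 𝕋 → E) : Continuous (fejerMean M F) := by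
  unfold fejerMean
  refine Continuous.const_smul (continuous_finsetSum _ fun i _ => continuous_finsetSum _
    fun j _ => ?_) _
  exact (fourier _).continuous.smul continuous_const

/-- The multiplier attached to the frequency `m` by the Fejér mean of order `M`. -/
def fejerWeight (M : ℕ) (m : ℤ) : ℝ :=
  (M + 1 : ℝ)⁻¹ * ∑ i ∈ Finset.range (M + 1), ∑ j ∈ Finset.range (M + 1),
    if (i : ℤ) - j = m then 1 else 0

lemma tendsto_fejerWeight (m : ℤ) : Tendsto (fun M => fejerWeight M m) atTop (𝓝 1) := by
  have hinner : ∀ M i : ℕ, (∑ j ∈ Finset.range (M + 1), if (i : ℤ) - j = m then (1 : ℝ) else 0)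
      ≤ 1 := fun M i => by
    rw [Finset.sum_boole, Nat.cast_le_one]
    refine Finset.card_le_one.2 fun a ha b hb => ?_
    simp only [Finset.mem_filter] at ha hb
    omega
  have hinner' : ∀ M i : ℕ, i ∈ Finset.Ico m.natAbs (M + 1 - m.natAbs) →
      1 ≤ ∑ j ∈ Finset.range (M + 1), if (i : ℤ) - j = m then (1 : ℝ) else 0 := fun M i hi => by
    rw [Finset.sum_boole, Nat.one_le_cast]
    rw [Finset.mem_Ico] at hi
    refine Finset.card_pos.2 ⟨((i : ℤ) - m).toNat, ?_⟩
    simp only [Finset.mem_filter, Finset.mem_range]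
    omega
  have hup : ∀ M, fejerWeight M m ≤ 1 := fun M => by
    have hM : (0 : ℝ) < M + 1 := by positivity
    rw [fejerWeight, inv_mul_le_iff₀ hM, mul_one]
    refine (Finset.sum_le_sum fun i _ => hinner M i).trans ?_
    simp
  have hlow : ∀ M : ℕ, 1 - (2 * m.natAbs : ℝ) * (1 / ((M : ℝ) + 1)) ≤ fejerWeight M m := fun M => by
    have hM : (0 : ℝ) < M + 1 := by positivity
    rw [fejerWeight, le_inv_mul_iff₀ hM]
    have h1 : ((M : ℝ) + 1) * (1 - (2 * m.natAbs : ℝ) * (1 / ((M : ℝ) + 1)))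
        = M + 1 - 2 * m.natAbs := by field_simp
    rw [h1]
    have h2 : Finset.Ico m.natAbs (M + 1 - m.natAbs) ⊆ Finset.range (M + 1) := fun i hi => by
      simp only [Finset.mem_Ico, Finset.mem_range] at *; omega
    refine le_trans ?_ (Finset.sum_le_sum_of_subset_of_nonneg h2 fun i _ _ =>
      Finset.sum_nonneg fun j _ => by split_ifs <;> norm_num)
    refine le_trans ?_ (Finset.sum_le_sum fun i hi => hinner' M i hi)
    simp only [Finset.sum_const, Nat.card_Ico, nsmul_eq_mul, mul_one]
    have : (M + 1 : ℤ) - 2 * m.natAbs ≤ ((M + 1 - m.natAbs - m.natAbs : ℕ) : ℤ) := by omega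
    exact_mod_cast this
  refine tendsto_of_tendsto_of_tendsto_of_le_of_le ?_ tendsto_const_nhds hlow hup
  simpa using tendsto_const_nhds.sub
    (tendsto_one_div_add_atTop_nhds_zero_nat.const_mul (2 * m.natAbs : ℝ))

lemma fourierCoeff_fourier_mul_const (n m : ℤ) (c : ℂ) :
    fourierCoeff (fun t : 𝕋 => fourier n t * c) m = if n = m then c else 0 := by
  have h : (fun t : 𝕋 => fourier n t * c) = fun t => c * fourier n t := by
    ext t; ring
  rw [h, fourierCoeff.const_mul, fourierCoeff_fourier, Pi.single_apply]
  by_cases hnm : n = m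
  · simp [hnm]
  · simp [hnm, Ne.symm hnm]

lemma fejerMean_fourier (M : ℕ) (m : ℤ) :
    fejerMean M (fourier m : 𝕋 → ℂ) = (fejerWeight M m : ℂ) • (fourier m : 𝕋 → ℂ) := by
  ext t
  simp only [fejerMean, fourierCoeff_fourier, fejerWeight, Pi.smul_apply, smul_eq_mul,
    Pi.single_apply]
  push_cast
  rw [mul_assoc, Finset.sum_mul]
  congr 1
  refine Finset.sum_congr rfl fun i _ => ?_
  rw [Finset.sum_mul]
  refine Finset.sum_congr rfl fun j _ => ?_
  split_ifs with h
  · rw [h]; simp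
  · simp

lemma fourierCoeff_fejerMean (M : ℕ) (f : 𝕋 → ℂ) (m : ℤ) :
    fourierCoeff (fejerMean M f) m = fejerWeight M m * fourierCoeff f m := by
  have hi : ∀ n : ℤ, Integrable (fun t : 𝕋 => fourier n t * fourierCoeff f n) μ𝕋 :=
    fun n => (integrable_fourier n).mul_const _
  have h : fejerMean M f = fun t => (M + 1 : ℂ)⁻¹ * ∑ p ∈ Finset.range (M + 1) ×ˢ
      Finset.range (M + 1), (fun (p : ℕ × ℕ) (t : 𝕋) => fourier ((p.1 : ℤ) - p.2) t *
        fourierCoeff f ((p.1 : ℤ) - p.2)) p t := by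
    ext t
    simp only [fejerMean, smul_eq_mul, Finset.sum_product]
  rw [h, fourierCoeff.const_mul]
  have h2 := congrFun (fourierCoeff.sum (Finset.range (M + 1) ×ˢ Finset.range (M + 1))
    (fun (p : ℕ × ℕ) (t : 𝕋) => fourier ((p.1 : ℤ) - p.2) t * fourierCoeff f ((p.1 : ℤ) - p.2))
    fun p _ => hi _) m
  have h3 : (∑ p ∈ Finset.range (M + 1) ×ˢ Finset.range (M + 1), (fun (p : ℕ × ℕ) (t : 𝕋) =>
      fourier ((p.1 : ℤ) - p.2) t * fourierCoeff f ((p.1 : ℤ) - p.2)) p) = fun t =>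
      ∑ p ∈ Finset.range (M + 1) ×ˢ Finset.range (M + 1), (fun (p : ℕ × ℕ) (t : 𝕋) =>
      fourier ((p.1 : ℤ) - p.2) t * fourierCoeff f ((p.1 : ℤ) - p.2)) p t := by
    ext t; rw [Finset.sum_apply]
  rw [h3] at h2
  rw [h2, Finset.sum_apply, fejerWeight]
  simp only [fourierCoeff_fourier_mul_const]
  push_cast
  rw [mul_assoc, Finset.sum_product, Finset.sum_mul]
  congr 1
  refine Finset.sum_congr rfl fun i _ => ?_
  rw [Finset.sum_mul]
  refine Finset.sum_congr rfl fun j _ => ?_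
  split_ifs with h
  · rw [h]; simp
  · simp

/-- The functions whose Fejér means converge to them in `L^p`. -/
def FejerConverges (p : ℝ≥0∞) (f : 𝕋 → ℂ) : Prop :=
  Tendsto (fun M => eLpNorm (fejerMean M f - f) p μ𝕋) atTop (𝓝 0)

lemma FejerConverges.congr {p : ℝ≥0∞} {f g : 𝕋 → ℂ} (hf : FejerConverges p f)
    (h : f =ᵐ[μ𝕋] g) : FejerConverges p g := by
  refine Tendsto.congr (fun M => ?_) hf
  rw [fejerMean_congr_ae M h]
  exact eLpNorm_congr_ae (EventuallyEq.rfl.sub h)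

lemma fejerConverges_fourier {p : ℝ≥0∞} (m : ℤ) : FejerConverges p (fourier m : 𝕋 → ℂ) := by
  have h1 : ∀ M, eLpNorm (fejerMean M (fourier m : 𝕋 → ℂ) - (fourier m : 𝕋 → ℂ)) p μ𝕋
      = ‖((fejerWeight M m : ℂ) - 1)‖ₑ * eLpNorm (fourier m : 𝕋 → ℂ) p μ𝕋 := fun M => by
    rw [fejerMean_fourier, ← eLpNorm_const_smul, sub_smul, one_smul]
  have h2 : eLpNorm (fourier m : 𝕋 → ℂ) p μ𝕋 ≠ ⊤ :=
    ((fourier m).continuous.memLp_of_hasCompactSupport (HasCompactSupport.of_compactSpace _)).2.ne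
  have h3 : Tendsto (fun M => ‖((fejerWeight M m : ℂ) - 1)‖ₑ) atTop (𝓝 0) := by
    have := (((Complex.continuous_ofReal.tendsto 1).comp
      (tendsto_fejerWeight m)).sub_const 1).enorm
    simpa using this
  unfold FejerConverges
  simp_rw [h1]
  simpa using ENNReal.Tendsto.mul_const h3 (Or.inr h2)

lemma FejerConverges.add {p : ℝ≥0∞} (hp : 1 ≤ p) {f g : 𝕋 → ℂ} (hf : FejerConverges p f)
    (hg : FejerConverges p g) (hfp : MemLp f p μ𝕋) (hgp : MemLp g p μ𝕋) :
    FejerConverges p (f + g) := by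
  have hle : ∀ M, eLpNorm (fejerMean M (f + g) - (f + g)) p μ𝕋 ≤
      eLpNorm (fejerMean M f - f) p μ𝕋 + eLpNorm (fejerMean M g - g) p μ𝕋 := fun M => by
    rw [fejerMean_add M (hfp.integrable hp) (hgp.integrable hp), add_sub_add_comm]
    exact eLpNorm_add_le ((continuous_fejerMean M f).aestronglyMeasurable.sub hfp.1)
      ((continuous_fejerMean M g).aestronglyMeasurable.sub hgp.1) hp
  have hsum := Tendsto.add hf hg
  rw [add_zero] at hsum
  exact tendsto_of_tendsto_of_tendsto_of_le_of_le tendsto_const_nhds hsum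
    (fun _ => zero_le) hle

lemma FejerConverges.const_smul {p : ℝ≥0∞} {f : 𝕋 → ℂ} (hf : FejerConverges p f) (c : ℂ) :
    FejerConverges p (c • f) := by
  have heq : ∀ M, eLpNorm (fejerMean M (c • f) - c • f) p μ𝕋 =
      ‖c‖ₑ * eLpNorm (fejerMean M f - f) p μ𝕋 := fun M => by
    rw [fejerMean_const_smul, ← smul_sub, eLpNorm_const_smul]
  unfold FejerConverges at *
  simp_rw [heq]
  simpa using ENNReal.Tendsto.const_mul hf (Or.inr enorm_ne_top)

/-- Fejér means of a scalar function converge in `L^p` for finite `p`. -/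
lemma fejerConverges_of_memLp {p : ℝ≥0∞} (hp : 1 ≤ p) (hp' : p ≠ ⊤) {f : 𝕋 → ℂ}
    (hf : MemLp f p μ𝕋) :
    FejerConverges p f := by
  have : Fact (1 ≤ p) := ⟨hp⟩
  have hmeas : ∀ (M : ℕ) (f : 𝕋 → ℂ), AEStronglyMeasurable (fejerMean M f) μ𝕋 := fun M f =>
    (continuous_fejerMean M f).aestronglyMeasurable
  have hspan : ∀ T ∈ Submodule.span ℂ (Set.range (@fourierLp (2 * Real.pi) _ p _)),
      FejerConverges p (T : 𝕋 → ℂ) := by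
    intro T hT
    induction hT using Submodule.span_induction with
    | mem T hT =>
      obtain ⟨m, rfl⟩ := hT
      exact (fejerConverges_fourier m).congr (coeFn_fourierLp p m).symm
    | zero =>
      refine ((fejerConverges_fourier 0).const_smul 0).congr ?_
      rw [zero_smul]
      exact (Lp.coeFn_zero ℂ p μ𝕋).symm
    | add x y _ _ hx hy =>
      exact (hx.add hp hy (Lp.memLp x) (Lp.memLp y)).congr (Lp.coeFn_add x y).symm
    | smul c x _ hx => exact (hx.const_smul c).congr (Lp.coeFn_smul c x).symm
  refine ENNReal.tendsto_nhds_zero.2 fun ε hε => ?_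
  have hε3 : 0 < ε / 3 := ENNReal.div_pos hε.ne' (by finiteness)
  have hcl : hf.toLp f ∈ closure
      (Submodule.span ℂ (Set.range (@fourierLp (2 * Real.pi) _ p _)) : Set (Lp ℂ p μ𝕋)) := by
    rw [← Submodule.topologicalClosure_coe, span_fourierLp_closure_eq_top hp']
    trivial
  obtain ⟨T, hTm, hTc, hd⟩ : ∃ T : 𝕋 → ℂ, MemLp T p μ𝕋 ∧ FejerConverges p T ∧
      eLpNorm (f - T) p μ𝕋 ≤ ε / 3 := by
    have hfin : min (ε / 3) 1 ≠ ⊤ := ((min_le_right _ _).trans_lt ENNReal.one_lt_top).ne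
    obtain ⟨T, hT, hTd⟩ := Metric.mem_closure_iff.1 hcl (min (ε / 3) 1).toReal
      (ENNReal.toReal_pos (lt_min hε3 one_pos).ne' hfin)
    refine ⟨T, Lp.memLp T, hspan T hT, ?_⟩
    have h1 : eLpNorm (⇑(hf.toLp f) - ⇑T) p μ𝕋 = eLpNorm (f - ⇑T) p μ𝕋 :=
      eLpNorm_congr_ae (hf.coeFn_toLp.sub EventuallyEq.rfl)
    rw [Lp.dist_def, h1] at hTd
    exact ((ENNReal.toReal_lt_toReal (hf.sub (Lp.memLp T)).2.ne hfin).1 hTd).le.trans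
      (min_le_left _ _)
  filter_upwards [ENNReal.tendsto_nhds_zero.1 hTc (ε / 3) hε3] with M hM
  have hfi := hf.integrable hp
  have hTi := hTm.integrable hp
  calc eLpNorm (fejerMean M f - f) p μ𝕋
      = eLpNorm ((fejerMean M (f - T) + (fejerMean M T - T)) + (T - f)) p μ𝕋 := by
        rw [fejerMean_sub M hfi hTi]; congr 1; abel
    _ ≤ eLpNorm (fejerMean M (f - T)) p μ𝕋 + eLpNorm (fejerMean M T - T) p μ𝕋
        + eLpNorm (T - f) p μ𝕋 := by
        refine (eLpNorm_add_le ((hmeas _ _).add ((hmeas _ _).sub hTm.1)) (hTm.1.sub hf.1) hp).trans ?_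
        gcongr
        exact eLpNorm_add_le (hmeas _ _) ((hmeas _ _).sub hTm.1) hp
    _ ≤ ε / 3 + ε / 3 + ε / 3 := by
        gcongr
        · exact (eLpNorm_fejerMean_le M hp hp' (hfi.sub hTi)).trans hd
        · rwa [eLpNorm_sub_comm]
    _ = ε := ENNReal.add_thirds ε

/-- An integrable function is determined by its Fourier coefficients. -/
lemma ae_eq_of_fourierCoeff_eq {f g : 𝕋 → ℂ} (hf : Integrable f μ𝕋) (hg : Integrable g μ𝕋)
    (h : ∀ n, fourierCoeff f n = fourierCoeff g n) : f =ᵐ[μ𝕋] g := by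
  have h0 : ∀ M, fejerMean M (f - g) = 0 := fun M => by
    rw [fejerMean_sub M hf hg]
    ext t
    simp [fejerMean, h]
  have hlim := fejerConverges_of_memLp le_rfl ENNReal.one_ne_top
    (memLp_one_iff_integrable.2 (hf.sub hg))
  unfold FejerConverges at hlim
  simp only [h0, zero_sub, eLpNorm_neg] at hlim
  have := tendsto_nhds_unique tendsto_const_nhds hlim
  rw [eLpNorm_eq_zero_iff (hf.sub hg).1 one_ne_zero] at this
  filter_upwards [this] with t ht
  simpa [sub_eq_zero] using ht

end FejerConvergence

section Analytic

lemma fourierCoeff_mul_eq_sum {g h : 𝕋 → ℂ} (hg : MemLp g 2 μ𝕋) (hh : MemLp h 2 μ𝕋)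
    (hg0 : ∀ n < 0, fourierCoeff g n = 0) (hh0 : ∀ n < 0, fourierCoeff h n = 0) (n : ℤ) :
    fourierCoeff (fun t => g t * h t) n =
      ∑ j ∈ Finset.Icc 0 n, fourierCoeff g j * fourierCoeff h (n - j) := by
  have hbd : MemLp (fun t : 𝕋 => fourier n t * conj (h t)) 2 μ𝕋 := by
    have h1 : MemLp (fun t => conj (h t)) 2 μ𝕋 :=
      hh.of_le (Complex.continuous_conj.comp_aestronglyMeasurable hh.1) (by simp)
    refine h1.of_le ((fourier n).continuous.aestronglyMeasurable.mul h1.1) (ae_of_all _ fun t => ?_)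
    rw [norm_mul, fourier_apply, Circle.norm_coe, one_mul]
  set x : Lp ℂ 2 μ𝕋 := hbd.toLp _ with hx
  set y : Lp ℂ 2 μ𝕋 := hg.toLp _ with hy
  have hs := fourierBasis.hasSum_inner_mul_inner x y
  have hb : ∀ (z : Lp ℂ 2 μ𝕋) (i : ℤ), inner ℂ (fourierBasis i) z = fourierCoeff z i := by
    intro z i
    rw [← fourierBasis_repr, HilbertBasis.repr_apply_apply]
  have hxi : ∀ i, inner ℂ x (fourierBasis i) = fourierCoeff h (n - i) := by
    intro i
    rw [← inner_conj_symm, hb, fourierCoeff_congr_ae hbd.coeFn_toLp, fourierCoeff, fourierCoeff,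
      ← integral_conj]
    refine integral_congr_ae (ae_of_all _ fun t => ?_)
    simp only [smul_eq_mul, map_mul, Complex.conj_conj]
    rw [neg_sub, sub_eq_add_neg, fourier_add, ← mul_assoc, ← fourier_neg, ← fourier_neg, neg_neg]
  have hyi : ∀ i, inner ℂ (fourierBasis i) y = fourierCoeff g i := by
    intro i
    rw [hb, fourierCoeff_congr_ae hg.coeFn_toLp]
  have hxy : inner ℂ x y = fourierCoeff (fun t => g t * h t) n := by
    rw [L2.inner_def, fourierCoeff]
    refine integral_congr_ae ?_
    filter_upwards [hbd.coeFn_toLp, hg.coeFn_toLp] with t h1 h2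
    rw [hx, hy, h1, h2]
    simp only [RCLike.inner_apply, smul_eq_mul, map_mul, Complex.conj_conj]
    rw [fourier_neg]
    ring
  rw [hxy] at hs
  simp only [hxi, hyi] at hs
  refine hs.unique ?_
  have : ∀ j ∉ Finset.Icc 0 n, fourierCoeff h (n - j) * fourierCoeff g j = 0 := by
    intro j hj
    rw [Finset.mem_Icc, not_and_or, not_le, not_le] at hj
    rcases hj with hj | hj
    · rw [hg0 j hj, mul_zero]
    · rw [hh0 (n - j) (by linarith), zero_mul]
  simp_rw [mul_comm (fourierCoeff g _)]
  exact hasSum_sum_of_ne_finset_zero this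

lemma ContinuousMap.memLp_circle (f : C(𝕋, ℂ)) (p : ℝ≥0∞) : MemLp f p μ𝕋 :=
  f.continuous.memLp_of_hasCompactSupport (HasCompactSupport.of_compactSpace _)

lemma ContinuousMap.integrable_circle (f : C(𝕋, ℂ)) : Integrable f μ𝕋 :=
  f.continuous.integrable_of_hasCompactSupport (HasCompactSupport.of_compactSpace _)

/-- The disc algebra, as the algebra of continuous functions on the circle whose negative Fourier
coefficients vanish. -/
def discAlgebra : Subalgebra ℂ C(𝕋, ℂ) where
  carrier := {f | ∀ n < 0, fourierCoeff f n = 0}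
  mul_mem' {f g} hf hg n hn := by
    have := fourierCoeff_mul_eq_sum (f.memLp_circle 2) (g.memLp_circle 2) hf hg n
    rwa [Finset.Icc_eq_empty (not_le.2 hn), Finset.sum_empty] at this
  add_mem' {f g} hf hg n hn := by
    have := congrFun (fourierCoeff.add f.integrable_circle g.integrable_circle) n
    rw [ContinuousMap.coe_add, this, Pi.add_apply, hf n hn, hg n hn, add_zero]
  algebraMap_mem' c n hn := by
    have : (algebraMap ℂ C(𝕋, ℂ) c : 𝕋 → ℂ) = fun t : 𝕋 => fourier 0 t * c := by
      ext t
      rw [fourier_zero, one_mul]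
      rfl
    rw [this, fourierCoeff_fourier_mul_const, if_neg hn.ne']

lemma fourier_mem_discAlgebra {n : ℤ} (hn : 0 ≤ n) : fourier n ∈ discAlgebra := fun m hm => by
  rw [fourierCoeff_fourier, Pi.single_apply, if_neg (hm.trans_le hn).ne]

lemma isClosed_discAlgebra : IsClosed (discAlgebra : Set C(𝕋, ℂ)) := by
  have hc : ∀ n, Continuous fun f : C(𝕋, ℂ) => fourierCoeff f n := fun n => by
    have h1 : ∀ f : C(𝕋, ℂ), fourierCoeff f n =
        inner ℂ (fourierBasis n) (ContinuousMap.toLp 2 μ𝕋 ℂ f) := fun f => by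
      rw [← fourierCoeff_toLp, ← fourierBasis_repr, HilbertBasis.repr_apply_apply]
    simp_rw [h1]
    exact continuous_const.inner (ContinuousMap.toLp 2 μ𝕋 ℂ).continuous
  have : (discAlgebra : Set C(𝕋, ℂ)) = ⋂ n : ℤ, ⋂ _ : n < 0, {f : C(𝕋, ℂ) | fourierCoeff f n = 0} := by
    ext f
    simp only [Set.mem_iInter, Set.mem_ofPred_eq]
    rfl
  rw [this]
  exact isClosed_iInter fun n => isClosed_iInter fun _ => isClosed_eq (hc n) continuous_const

lemma exp_mem_discAlgebra {P : C(𝕋, ℂ)} (hP : P ∈ discAlgebra) :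
    (⟨fun t => Complex.exp (P t), by fun_prop⟩ : C(𝕋, ℂ)) ∈ discAlgebra := by
  have h : (⟨fun t => Complex.exp (P t), by fun_prop⟩ : C(𝕋, ℂ)) = NormedSpace.exp P := by
    ext t
    have := NormedSpace.map_exp (ContinuousMap.evalAlgHom ℂ ℂ t) (continuous_eval_const t) P
    rw [← Complex.exp_eq_exp_ℂ] at this
    exact this.symm
  rw [h]
  exact NormedSpace.exp_mem (R := ℂ) isClosed_discAlgebra hP

/-- Real continuous functions on the circle are uniform limits of real parts of elements of the
disc algebra. -/
lemma exists_discAlgebra_re_near (u : C(𝕋, ℝ)) {δ : ℝ} (hδ : 0 < δ) :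
    ∃ P ∈ discAlgebra, ∀ t, |(P t).re - u t| < δ := by
  have key : ∀ Q ∈ Submodule.span ℂ (Set.range (@fourier (2 * Real.pi))), ∀ c : ℂ,
      ∃ P ∈ discAlgebra, ∀ t, (P t).re = (c * Q t).re := by
    intro Q hQ
    induction hQ using Submodule.span_induction with
    | mem Q hQ =>
      obtain ⟨n, rfl⟩ := hQ
      intro c
      rcases le_or_gt 0 n with hn | hn
      · exact ⟨c • fourier n, discAlgebra.smul_mem (fourier_mem_discAlgebra hn) c, fun t => rfl⟩
      · refine ⟨conj c • fourier (-n), discAlgebra.smul_mem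
          (fourier_mem_discAlgebra (by linarith)) _, fun t => ?_⟩
        rw [ContinuousMap.smul_apply, fourier_neg, smul_eq_mul, ← map_mul, Complex.conj_re]
    | zero => exact fun c => ⟨0, discAlgebra.zero_mem, fun t => by simp⟩
    | add x y _ _ hx hy =>
      intro c
      obtain ⟨P, hP, hPt⟩ := hx c
      obtain ⟨R, hR, hRt⟩ := hy c
      refine ⟨P + R, discAlgebra.add_mem hP hR, fun t => ?_⟩
      rw [ContinuousMap.add_apply, ContinuousMap.add_apply, mul_add, Complex.add_re, Complex.add_re,
        hPt, hRt]
    | smul a x _ hx =>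
      intro c
      obtain ⟨P, hP, hPt⟩ := hx (c * a)
      refine ⟨P, hP, fun t => ?_⟩
      rw [hPt, ContinuousMap.smul_apply, smul_eq_mul, mul_assoc]
  set U : C(𝕋, ℂ) := ⟨fun t => (u t : ℂ), by fun_prop⟩ with hU
  have hcl : U ∈ closure (Submodule.span ℂ (Set.range (@fourier (2 * Real.pi))) :
      Set C(𝕋, ℂ)) := by
    rw [← Submodule.topologicalClosure_coe, span_fourier_closure_eq_top]
    trivial
  obtain ⟨Q, hQ, hQd⟩ := Metric.mem_closure_iff.1 hcl δ hδ
  obtain ⟨P, hP, hPt⟩ := key Q hQ 1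
  refine ⟨P, hP, fun t => ?_⟩
  have h1 : ‖Q t - U t‖ < δ := by
    rw [← dist_eq_norm, dist_comm]
    exact (ContinuousMap.dist_apply_le_dist t).trans_lt hQd
  refine lt_of_le_of_lt ?_ h1
  rw [hPt, one_mul]
  simpa [hU] using Complex.abs_re_le_norm (Q t - U t)

end Analytic

section SeqVec

/-- The first `N` terms of a sequence of functions, as a function valued in `ℓ_q^N`. -/
def seqVec (q : ℝ≥0∞) (N : ℕ) (f : ℕ → 𝕋 → ℂ) (t : 𝕋) : PiLp q (fun _ : Fin N => ℂ) :=
  WithLp.toLp q fun k => f k t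

lemma norm_seqVec {q : ℝ≥0∞} (hq : 0 < q.toReal) (N : ℕ) (f : ℕ → 𝕋 → ℂ) (t : 𝕋) :
    ‖seqVec q N f t‖ = (∑ k ∈ Finset.range N, ‖f k t‖ ^ q.toReal) ^ (1 / q.toReal) := by
  rw [PiLp.norm_eq_sum hq, Finset.sum_range]
  rfl

lemma enorm_seqVec {q : ℝ≥0∞} [Fact (1 ≤ q)] (hq : 0 < q.toReal) (N : ℕ) (f : ℕ → 𝕋 → ℂ)
    (t : 𝕋) :
    ‖seqVec q N f t‖ₑ = (∑ k ∈ Finset.range N, (‖f k t‖₊ : ℝ≥0∞) ^ q.toReal) ^ (1 / q.toReal) := by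
  rw [← ofReal_norm, norm_seqVec hq,
    ← ENNReal.ofReal_rpow_of_nonneg (Finset.sum_nonneg fun _ _ => by positivity) (by positivity),
    ENNReal.ofReal_sum_of_nonneg fun _ _ => by positivity]
  congr 1
  refine Finset.sum_congr rfl fun k _ => ?_
  rw [← ENNReal.ofReal_rpow_of_nonneg (norm_nonneg _) hq.le, ofReal_norm]
  rfl

lemma aestronglyMeasurable_seqVec (q : ℝ≥0∞) [Fact (1 ≤ q)] (N : ℕ) {f : ℕ → 𝕋 → ℂ}
    (hf : ∀ k, AEStronglyMeasurable (f k) μ𝕋) : AEStronglyMeasurable (seqVec q N f) μ𝕋 := by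
  have h : AEStronglyMeasurable (fun t (k : Fin N) => f k t) μ𝕋 :=
    (aemeasurable_pi_lambda _ fun k : Fin N => (hf k).aemeasurable).aestronglyMeasurable
  exact (PiLp.continuous_toLp q _).comp_aestronglyMeasurable h

lemma eLpNorm_seqVec {p q : ℝ≥0∞} [Fact (1 ≤ q)] (hp : p ≠ 0) (hp' : p ≠ ⊤) (hq : 0 < q.toReal)
    (N : ℕ) (f : ℕ → 𝕋 → ℂ) : eLpNorm (seqVec q N f) p μ𝕋 =
      (∫⁻ t, ((∑ k ∈ Finset.range N, (‖f k t‖₊ : ℝ≥0∞) ^ q.toReal) ^ (1 / q.toReal)) ^ p.toReal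
        ∂μ𝕋) ^ (1 / p.toReal) := by
  rw [eLpNorm_eq_lintegral_rpow_enorm_toReal hp hp']
  simp_rw [enorm_seqVec hq]

lemma eLpNorm_seqVec_le {p q : ℝ≥0∞} [Fact (1 ≤ q)] (hp : p ≠ 0) (hp' : p ≠ ⊤)
    (hq : 0 < q.toReal) (N : ℕ) (f : ℕ → 𝕋 → ℂ) :
    eLpNorm (seqVec q N f) p μ𝕋 ≤ eLpLqNorm p.toReal q.toReal f := by
  rw [eLpNorm_seqVec hp hp' hq, eLpLqNorm]
  gcongr
  exact ENNReal.sum_le_tsum _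

lemma eLpNorm_seqVec_mono {p q : ℝ≥0∞} [Fact (1 ≤ q)] (hp : p ≠ 0) (hp' : p ≠ ⊤)
    (hq : 0 < q.toReal) {N N' : ℕ} (h : N ≤ N') (f : ℕ → 𝕋 → ℂ) :
    eLpNorm (seqVec q N f) p μ𝕋 ≤ eLpNorm (seqVec q N' f) p μ𝕋 := by
  rw [eLpNorm_seqVec hp hp' hq, eLpNorm_seqVec hp hp' hq]
  gcongr

lemma eLpLqNorm_le_of_forall {p q : ℝ≥0∞} [Fact (1 ≤ q)] (hp : p ≠ 0) (hp' : p ≠ ⊤)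
    (hq : 0 < q.toReal) {f : ℕ → 𝕋 → ℂ} (hf : ∀ k, AEStronglyMeasurable (f k) μ𝕋) {C : ℝ≥0∞}
    (h : ∀ N, eLpNorm (seqVec q N f) p μ𝕋 ≤ C) : eLpLqNorm p.toReal q.toReal f ≤ C := by
  have hpr : 0 < p.toReal := ENNReal.toReal_pos hp hp'
  set F : ℕ → 𝕋 → ℝ≥0∞ := fun N t =>
    ((∑ k ∈ Finset.range N, (‖f k t‖₊ : ℝ≥0∞) ^ q.toReal) ^ (1 / q.toReal)) ^ p.toReal with hF
  have hm : ∀ N, AEMeasurable (F N) μ𝕋 := fun N =>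
    ((Finset.aemeasurable_fun_sum _ fun k _ =>
      ((hf k).enorm.pow_const q.toReal)).pow_const _).pow_const _
  have hmono : ∀ᵐ t ∂μ𝕋, Monotone fun N => F N t := ae_of_all _ fun t N N' hN => by
    simp only [hF]
    gcongr
  have hlim : ∀ᵐ t ∂μ𝕋, Tendsto (fun N => F N t) atTop
      (𝓝 (((∑' k, (‖f k t‖₊ : ℝ≥0∞) ^ q.toReal) ^ (1 / q.toReal)) ^ p.toReal)) :=
    ae_of_all _ fun t => by
      refine (ENNReal.continuous_rpow_const.tendsto _).comp
        ((ENNReal.continuous_rpow_const.tendsto _).comp ?_)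
      exact ENNReal.tendsto_nat_tsum _
  have := lintegral_tendsto_of_tendsto_of_monotone hm hmono hlim
  rw [eLpLqNorm, one_div p.toReal, ENNReal.rpow_inv_le_iff hpr]
  refine le_of_tendsto' this fun N => ?_
  have hN := h N
  rw [eLpNorm_seqVec hp hp' hq, one_div p.toReal, ENNReal.rpow_inv_le_iff hpr] at hN
  exact hN

lemma sum_sq_le_of_le {ι : Type*} {s : Finset ι} {a x : ι → ℝ} {c S : ℝ} (ha : ∀ k ∈ s, 0 < a k)
    (hS : S = ∑ k ∈ s, a k ^ (4 / 3 : ℝ)) (hS0 : 0 < S) (hx0 : ∀ k ∈ s, 0 ≤ x k)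
    (hx : ∀ k ∈ s, x k ≤ c * (a k ^ (2 / 3 : ℝ) * S ^ (-(1 / 8) : ℝ))) :
    ∑ k ∈ s, x k ^ (2 : ℝ) ≤ c ^ 2 * S ^ (3 / 4 : ℝ) := by
  calc ∑ k ∈ s, x k ^ (2 : ℝ)
      ≤ ∑ k ∈ s, c ^ 2 * S ^ (-(1 / 4) : ℝ) * a k ^ (4 / 3 : ℝ) := by
        refine Finset.sum_le_sum fun k hk => ?_
        have h1 : (a k ^ (2 / 3 : ℝ)) ^ 2 = a k ^ (4 / 3 : ℝ) := by
          rw [← Real.rpow_natCast, ← Real.rpow_mul (ha k hk).le]; norm_num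
        have h2 : (S ^ (-(1 / 8) : ℝ)) ^ 2 = S ^ (-(1 / 4) : ℝ) := by
          rw [← Real.rpow_natCast, ← Real.rpow_mul hS0.le]; norm_num
        calc x k ^ (2 : ℝ) = x k ^ 2 := Real.rpow_two _
          _ ≤ (c * (a k ^ (2 / 3 : ℝ) * S ^ (-(1 / 8) : ℝ))) ^ 2 :=
            pow_le_pow_left₀ (hx0 k hk) (hx k hk) 2
          _ = _ := by rw [mul_pow, mul_pow, h1, h2]; ring
    _ = c ^ 2 * (S ^ (-(1 / 4) : ℝ) * S ^ (1 : ℝ)) := by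
        rw [← Finset.mul_sum, ← hS, Real.rpow_one]; ring
    _ = c ^ 2 * S ^ (3 / 4 : ℝ) := by rw [← Real.rpow_add hS0]; norm_num

lemma sum_pow_four_le_of_le {ι : Type*} {s : Finset ι} {a x : ι → ℝ} {c S : ℝ}
    (ha : ∀ k ∈ s, 0 < a k) (hS : S = ∑ k ∈ s, a k ^ (4 / 3 : ℝ)) (hS0 : 0 < S)
    (hx0 : ∀ k ∈ s, 0 ≤ x k) (hx : ∀ k ∈ s, x k ≤ c * (a k ^ (1 / 3 : ℝ) * S ^ (1 / 8 : ℝ))) :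
    ∑ k ∈ s, x k ^ (4 : ℝ) ≤ (c ^ 2 * S ^ (3 / 4 : ℝ)) ^ 2 := by
  calc ∑ k ∈ s, x k ^ (4 : ℝ)
      ≤ ∑ k ∈ s, c ^ 4 * S ^ (1 / 2 : ℝ) * a k ^ (4 / 3 : ℝ) := by
        refine Finset.sum_le_sum fun k hk => ?_
        have h1 : (a k ^ (1 / 3 : ℝ)) ^ 4 = a k ^ (4 / 3 : ℝ) := by
          rw [← Real.rpow_natCast, ← Real.rpow_mul (ha k hk).le]; norm_num
        have h2 : (S ^ (1 / 8 : ℝ)) ^ 4 = S ^ (1 / 2 : ℝ) := by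
          rw [← Real.rpow_natCast, ← Real.rpow_mul hS0.le]; norm_num
        calc x k ^ (4 : ℝ) = x k ^ 4 := by rw [← Real.rpow_natCast]; norm_num
          _ ≤ (c * (a k ^ (1 / 3 : ℝ) * S ^ (1 / 8 : ℝ))) ^ 4 :=
            pow_le_pow_left₀ (hx0 k hk) (hx k hk) 4
          _ = _ := by rw [mul_pow, mul_pow, h1, h2]; ring
    _ = c ^ 4 * (S ^ (1 / 2 : ℝ) * S ^ (1 : ℝ)) := by
        rw [← Finset.mul_sum, ← hS, Real.rpow_one]; ring
    _ = (c ^ 2 * S ^ (3 / 4 : ℝ)) ^ 2 := by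
        have h3 : (S ^ (3 / 4 : ℝ)) ^ 2 = S ^ (3 / 2 : ℝ) := by
          rw [← Real.rpow_natCast, ← Real.rpow_mul hS0.le]; norm_num
        rw [mul_pow, h3, ← Real.rpow_add hS0, ← pow_mul]; norm_num

end SeqVec

section Factorization

lemma one_le_four_thirds : (1 : ℝ≥0∞) ≤ 4 / 3 := by
  rw [ENNReal.le_div_iff_mul_le (by norm_num) (by norm_num)]; norm_num

instance fact_one_le_four_thirds : Fact ((1 : ℝ≥0∞) ≤ 4 / 3) := ⟨one_le_four_thirds⟩

instance fact_one_le_four : Fact ((1 : ℝ≥0∞) ≤ 4) := ⟨by norm_num⟩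

lemma toReal_four_thirds : (4 / 3 : ℝ≥0∞).toReal = 4 / 3 := by
  rw [ENNReal.toReal_div]; norm_num

lemma eLpNorm_two_le_of_norm_sq_le {E : Type*} [NormedAddCommGroup E] {v : 𝕋 → E} {F : 𝕋 → ℝ}
    {c B D : ℝ} (hv : ∀ t, ‖v t‖ ^ 2 ≤ c ^ 2 * F t)
    (hF : ∫⁻ t, ENNReal.ofReal (F t) ∂μ𝕋 ≤ ENNReal.ofReal B) (hD : 0 ≤ D)
    (hB : c ^ 2 * B ≤ D ^ 2) : eLpNorm v 2 μ𝕋 ≤ ENNReal.ofReal D := by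
  rw [eLpNorm_eq_lintegral_rpow_enorm_toReal two_ne_zero ENNReal.ofNat_ne_top,
    ENNReal.toReal_ofNat, one_div, ENNReal.rpow_inv_le_iff two_pos]
  calc ∫⁻ t, ‖v t‖ₑ ^ (2 : ℝ) ∂μ𝕋
      ≤ ∫⁻ t, ENNReal.ofReal (c ^ 2) * ENNReal.ofReal (F t) ∂μ𝕋 := by
        refine lintegral_mono fun t => ?_
        rw [← ofReal_norm, ENNReal.rpow_two, ← ENNReal.ofReal_pow (norm_nonneg _),
          ← ENNReal.ofReal_mul (sq_nonneg c)]
        exact ENNReal.ofReal_le_ofReal (hv t)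
    _ = ENNReal.ofReal (c ^ 2) * ∫⁻ t, ENNReal.ofReal (F t) ∂μ𝕋 :=
        lintegral_const_mul' _ _ ENNReal.ofReal_ne_top
    _ ≤ ENNReal.ofReal (c ^ 2) * ENNReal.ofReal B := by gcongr
    _ = ENNReal.ofReal (c ^ 2 * B) := (ENNReal.ofReal_mul (sq_nonneg c)).symm
    _ ≤ ENNReal.ofReal D ^ (2 : ℝ) := by
        rw [ENNReal.rpow_two, ← ENNReal.ofReal_pow hD]
        exact ENNReal.ofReal_le_ofReal hB

/-- Approximate factorization of finitely many elements of the disc algebra. -/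
lemma exists_discAlgebra_factorization {N : ℕ} (hN : 0 < N) {φ : ℕ → C(𝕋, ℂ)}
    (hφ : ∀ k, φ k ∈ discAlgebra) (hφ1 : eLpNorm (seqVec (4 / 3) N fun k => φ k) 1 μ𝕋 ≤ 1)
    {η : ℝ} (hη : 0 < η) :
    ∃ g h : ℕ → C(𝕋, ℂ), (∀ k, g k ∈ discAlgebra) ∧ (∀ k, h k ∈ discAlgebra) ∧
      (∀ k < N, φ k = g k * h k) ∧ (∀ k, N ≤ k → g k = 0 ∧ h k = 0) ∧
      eLpNorm (seqVec 2 N fun k => g k) 2 μ𝕋 ≤ ENNReal.ofReal (1 + η) ∧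
      eLpNorm (seqVec 4 N fun k => h k) 2 μ𝕋 ≤ ENNReal.ofReal (1 + η) := by
  set C : ℝ := ‖seqVec (4 / 3) N (fun _ _ => 1) 0‖ with hC
  obtain ⟨ε, hε, hεη⟩ : ∃ ε > 0, Real.exp ε ^ 2 * (1 + ε * C) ≤ 1 + η := by
    have hcont : Continuous fun ε : ℝ => Real.exp ε ^ 2 * (1 + ε * C) := by fun_prop
    have hlt : ∀ᶠ ε in 𝓝 (0 : ℝ), Real.exp ε ^ 2 * (1 + ε * C) < 1 + η :=
      hcont.continuousAt.eventually_lt_const (by simpa using hη)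
    obtain ⟨ε, h1, h2⟩ := ((hlt.filter_mono nhdsWithin_le_nhds).and
      (self_mem_nhdsWithin : Set.Ioi (0 : ℝ) ∈ 𝓝[>] (0 : ℝ))).exists
    exact ⟨ε, h2, h1.le⟩
  set a : ℕ → 𝕋 → ℝ := fun k t => ‖φ k t‖ + ε with ha
  have ha0 : ∀ k t, 0 < a k t := fun k t => by positivity
  set S : 𝕋 → ℝ := fun t => ∑ k ∈ Finset.range N, a k t ^ (4 / 3 : ℝ) with hS
  have hS0 : ∀ t, 0 < S t := fun t =>
    Finset.sum_pos (fun k _ => Real.rpow_pos_of_pos (ha0 k t) _) ⟨0, Finset.mem_range.2 hN⟩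
  have hac : ∀ k, Continuous (a k) := fun k => by fun_prop
  have hSc : Continuous S := continuous_finsetSum _ fun k _ =>
    (hac k).rpow_const fun t => Or.inl (ha0 k t).ne'
  have hFint : ∫⁻ t, ENNReal.ofReal (S t ^ (3 / 4 : ℝ)) ∂μ𝕋 ≤ ENNReal.ofReal (1 + ε * C) := by
    have hF : ∀ t, S t ^ (3 / 4 : ℝ) ≤ ‖seqVec (4 / 3) N (fun k => φ k) t‖ + ε * C := fun t => by
      have h43 : 0 < (4 / 3 : ℝ≥0∞).toReal := by rw [toReal_four_thirds]; norm_num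
      have e1 : S t ^ (3 / 4 : ℝ) = ‖seqVec (4 / 3) N (fun k t => (a k t : ℂ)) t‖ := by
        rw [norm_seqVec h43, toReal_four_thirds]
        simp only [Complex.norm_real, Real.norm_of_nonneg (ha0 _ _).le]
        norm_num [hS]
      have e2 : ‖seqVec (4 / 3) N (fun k => φ k) t‖ =
          ‖seqVec (4 / 3) N (fun k t => (‖φ k t‖ : ℂ)) t‖ := by
        rw [norm_seqVec h43, norm_seqVec h43]
        simp
      have e3 : seqVec (4 / 3) N (fun k t => (a k t : ℂ)) t =
          seqVec (4 / 3) N (fun k t => (‖φ k t‖ : ℂ)) t +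
            (ε : ℂ) • seqVec (4 / 3) N (fun _ _ => 1) 0 := by
        ext k
        simp [seqVec, ha]
      rw [e1, e2, e3]
      refine (norm_add_le _ _).trans ?_
      rw [norm_smul, Complex.norm_real, Real.norm_of_nonneg hε.le]
    calc ∫⁻ t, ENNReal.ofReal (S t ^ (3 / 4 : ℝ)) ∂μ𝕋
        ≤ ∫⁻ t, (‖seqVec (4 / 3) N (fun k => φ k) t‖ₑ + ENNReal.ofReal (ε * C)) ∂μ𝕋 := by
          refine lintegral_mono fun t => (ENNReal.ofReal_le_ofReal (hF t)).trans ?_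
          rw [ENNReal.ofReal_add (norm_nonneg _) (by positivity), ofReal_norm]
      _ = eLpNorm (seqVec (4 / 3) N fun k => φ k) 1 μ𝕋 + ENNReal.ofReal (ε * C) := by
          rw [lintegral_add_right _ measurable_const, lintegral_const, measure_univ, mul_one,
            eLpNorm_one_eq_lintegral_enorm]
      _ ≤ 1 + ENNReal.ofReal (ε * C) := by gcongr
      _ = ENNReal.ofReal (1 + ε * C) := by
          rw [ENNReal.ofReal_add zero_le_one (by positivity), ENNReal.ofReal_one]
  have hB : Real.exp ε ^ 2 * (1 + ε * C) ≤ (1 + η) ^ 2 := by nlinarith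
  set u : ℕ → C(𝕋, ℝ) := fun k => ⟨fun t => 1 / 3 * Real.log (a k t) + 1 / 8 * Real.log (S t),
    (continuous_const.mul ((hac k).log fun t => (ha0 k t).ne')).add
      (continuous_const.mul (hSc.log fun t => (hS0 t).ne'))⟩ with hu
  have hexpu : ∀ k t, Real.exp (u k t) = a k t ^ (1 / 3 : ℝ) * S t ^ (1 / 8 : ℝ) := fun k t => by
    rw [Real.rpow_def_of_pos (ha0 k t), Real.rpow_def_of_pos (hS0 t), ← Real.exp_add]
    simp only [hu, ContinuousMap.coe_mk]
    ring_nf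
  choose P hP hPu using fun k => exists_discAlgebra_re_near (u k) hε
  set H : ℕ → C(𝕋, ℂ) := fun k => ⟨fun t => Complex.exp (P k t), by fun_prop⟩ with hH
  set G : ℕ → C(𝕋, ℂ) := fun k => φ k * ⟨fun t => Complex.exp ((-P k) t), by fun_prop⟩ with hG
  have hHn : ∀ k t, ‖H k t‖ ≤ Real.exp ε * (a k t ^ (1 / 3 : ℝ) * S t ^ (1 / 8 : ℝ)) :=
    fun k t => by
      rw [← hexpu, ← Real.exp_add]
      simp only [hH, ContinuousMap.coe_mk, Complex.norm_exp]
      exact Real.exp_le_exp.2 (by linarith [(abs_lt.1 (hPu k t)).2])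
  have hGn : ∀ k t, ‖G k t‖ ≤ Real.exp ε * (a k t ^ (2 / 3 : ℝ) * S t ^ (-(1 / 8) : ℝ)) :=
    fun k t => by
      have e1 : a k t ^ (2 / 3 : ℝ) * S t ^ (-(1 / 8) : ℝ) = a k t * Real.exp (-u k t) := by
        rw [Real.exp_neg, hexpu, mul_inv, Real.rpow_neg (hS0 t).le, ← mul_assoc]
        congr 1
        rw [← Real.rpow_neg (ha0 k t).le]
        nth_rewrite 2 [← Real.rpow_one (a k t)]
        rw [← Real.rpow_add (ha0 k t)]
        norm_num
      have e2 : ‖G k t‖ = ‖φ k t‖ * Real.exp (-(P k t).re) := by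
        simp only [hG, ContinuousMap.mul_apply, ContinuousMap.coe_mk, norm_mul, Complex.norm_exp,
          ContinuousMap.neg_apply, Complex.neg_re]
      rw [e1, e2, mul_left_comm, ← Real.exp_add]
      gcongr
      · simp only [ha]; linarith
      · linarith [(abs_lt.1 (hPu k t)).1]
  refine ⟨fun k => if k < N then G k else 0, fun k => if k < N then H k else 0, fun k => ?_,
    fun k => ?_, fun k hk => ?_, fun k hk => ?_, ?_, ?_⟩
  · dsimp only
    split_ifs
    · exact discAlgebra.mul_mem (hφ k) (exp_mem_discAlgebra (discAlgebra.neg_mem (hP k)))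
    · exact discAlgebra.zero_mem
  · dsimp only
    split_ifs
    · exact exp_mem_discAlgebra (hP k)
    · exact discAlgebra.zero_mem
  · ext t
    simp only [if_pos hk, hG, hH, ContinuousMap.mul_apply, ContinuousMap.coe_mk,
      ContinuousMap.neg_apply, mul_assoc, ← Complex.exp_add]
    simp
  · simp [not_lt.2 hk]
  · refine eLpNorm_two_le_of_norm_sq_le (fun t => ?_) hFint (by positivity) hB
    rw [norm_seqVec (by norm_num), ENNReal.toReal_ofNat, ← Real.rpow_natCast, ← Real.rpow_mul
      (Finset.sum_nonneg fun _ _ => by positivity)]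
    norm_num only [Nat.cast_ofNat, Real.rpow_one]
    refine sum_sq_le_of_le (a := fun k => a k t) (fun k _ => ha0 k t) rfl (hS0 t)
      (fun _ _ => norm_nonneg _) fun k hk => ?_
    rw [if_pos (Finset.mem_range.1 hk)]
    exact hGn k t
  · refine eLpNorm_two_le_of_norm_sq_le (fun t => ?_) hFint (by positivity) hB
    rw [norm_seqVec (by norm_num), ENNReal.toReal_ofNat, ← Real.rpow_natCast, ← Real.rpow_mul
      (Finset.sum_nonneg fun _ _ => by positivity)]
    have hle := sum_pow_four_le_of_le (s := Finset.range N) (a := fun k => a k t)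
      (x := fun k => ‖(if k < N then H k else 0) t‖) (fun k _ => ha0 k t) rfl (hS0 t)
      (fun _ _ => norm_nonneg _) fun k hk => by
        rw [if_pos (Finset.mem_range.1 hk)]
        exact hHn k t
    have hsq := Real.rpow_le_rpow (Finset.sum_nonneg fun _ _ => by positivity) hle
      (by norm_num : (0 : ℝ) ≤ 1 / 2)
    have hS34 : 0 ≤ S t ^ (3 / 4 : ℝ) := Real.rpow_nonneg (hS0 t).le _
    rw [← Real.rpow_natCast (_ * _), ← Real.rpow_mul (by positivity)] at hsq
    norm_num at hsq ⊢
    exact hsq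

end Factorization

section Limits

lemma exists_subseq_tendsto {ι X : Type*} [Countable ι] [SeminormedAddCommGroup X] [ProperSpace X]
    {a : ℕ → ι → X} {B : ℝ} (ha : ∀ n i, ‖a n i‖ ≤ B) :
    ∃ (L : ι → X) (ψ : ℕ → ℕ), StrictMono ψ ∧
      ∀ i, Tendsto (fun n => a (ψ n) i) atTop (𝓝 (L i)) := by
  obtain ⟨L, -, ψ, hψ, hL⟩ :=
    (isCompact_univ_pi fun _ : ι => isCompact_closedBall (0 : X) B).tendsto_subseq
      (x := a) fun n i _ => by simpa using ha n i
  exact ⟨L, ψ, hψ, tendsto_pi_nhds.1 hL⟩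

lemma sum_norm_fourierCoeff_sq_le {f : 𝕋 → ℂ} (hf : MemLp f 2 μ𝕋) (s : Finset ℤ) :
    ∑ m ∈ s, ‖fourierCoeff f m‖ ^ 2 ≤ (eLpNorm f 2 μ𝕋).toReal ^ 2 := by
  have h := lp.sum_rpow_le_norm_rpow (p := 2) (by norm_num) (fourierBasis.repr (hf.toLp f)) s
  simpa only [fourierBasis_repr, LinearIsometryEquiv.norm_map, Lp.norm_toLp, ENNReal.toReal_ofNat,
    Real.rpow_two, fourierCoeff_congr_ae hf.coeFn_toLp] using h

lemma exists_memLp_fourierCoeff_eq {G : ℤ → ℂ} {B : ℝ}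
    (hG : ∀ s : Finset ℤ, ∑ m ∈ s, ‖G m‖ ^ 2 ≤ B) :
    ∃ v : 𝕋 → ℂ, MemLp v 2 μ𝕋 ∧ ∀ m, fourierCoeff v m = G m := by
  have hmem : Memℓp G 2 := memℓp_gen' (C := B) fun s => by simpa using hG s
  refine ⟨(fourierBasis.repr.symm ⟨G, hmem⟩ : Lp ℂ 2 μ𝕋), Lp.memLp _, fun m => ?_⟩
  rw [← fourierBasis_repr, LinearIsometryEquiv.apply_symm_apply]

variable {q : ℝ≥0∞} [Fact (1 ≤ q)]

lemma norm_le_norm_seqVec {N k : ℕ} (hk : k < N) (f : ℕ → 𝕋 → ℂ) (t : 𝕋) :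
    ‖f k t‖ ≤ ‖seqVec q N f t‖ :=
  PiLp.norm_apply_le (seqVec q N f t) ⟨k, hk⟩

lemma eLpNorm_le_eLpNorm_seqVec {N k : ℕ} (hk : k < N) (f : ℕ → 𝕋 → ℂ) (p : ℝ≥0∞) :
    eLpNorm (f k) p μ𝕋 ≤ eLpNorm (seqVec q N f) p μ𝕋 :=
  eLpNorm_mono (norm_le_norm_seqVec hk f)

lemma eLpNorm_seqVec_le_sum {p : ℝ≥0∞} (hp : 1 ≤ p) (N : ℕ) {f : ℕ → 𝕋 → ℂ}
    (hf : ∀ k, AEStronglyMeasurable (f k) μ𝕋) :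
    eLpNorm (seqVec q N f) p μ𝕋 ≤ ∑ k ∈ Finset.range N, eLpNorm (f k) p μ𝕋 := by
  calc eLpNorm (seqVec q N f) p μ𝕋
      ≤ eLpNorm (∑ k ∈ Finset.range N, fun t => ‖f k t‖) p μ𝕋 := by
        refine eLpNorm_mono_real fun t => ?_
        have : seqVec q N f t = ∑ k : Fin N, PiLp.single q k (f k t) := by
          ext j
          simp [seqVec]
        rw [this, Finset.sum_apply, Finset.sum_range]
        refine (norm_sum_le _ _).trans_eq (Finset.sum_congr rfl fun k _ => ?_)
        rw [PiLp.norm_single]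
    _ ≤ ∑ k ∈ Finset.range N, eLpNorm (fun t => ‖f k t‖) p μ𝕋 :=
        eLpNorm_sum_le (fun k _ => (hf k).norm) hp
    _ = _ := by simp only [eLpNorm_norm]

lemma integrable_seqVec (N : ℕ) {f : ℕ → 𝕋 → ℂ} (hf : ∀ k, Integrable (f k) μ𝕋) :
    Integrable (seqVec q N f) μ𝕋 := by
  refine memLp_one_iff_integrable.1 ⟨aestronglyMeasurable_seqVec q N fun k => (hf k).1,
    (eLpNorm_seqVec_le_sum le_rfl N fun k => (hf k).1).trans_lt ?_⟩
  exact ENNReal.sum_lt_top.2 fun k _ => (memLp_one_iff_integrable.2 (hf k)).2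

lemma seqVec_fejerMean (M N : ℕ) {f : ℕ → 𝕋 → ℂ} (hf : ∀ k, Integrable (f k) μ𝕋) :
    seqVec q N (fun k => fejerMean M (f k)) = fejerMean M (seqVec q N f) := by
  have hc : ∀ (n : ℤ) (k : Fin N), fourierCoeff (seqVec q N f) n k = fourierCoeff (f k) n :=
    fun n k => ((PiLp.proj q (fun _ : Fin N => ℂ) k : _ →L[ℂ] ℂ).integral_comp_comm
      ((integrable_seqVec N hf).fourier_smul (-n))).symm
  ext t k
  simp only [fejerMean, seqVec, PiLp.smul_apply, WithLp.ofLp_sum, Finset.sum_apply, WithLp.ofLp_smul,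
    Pi.smul_apply]
  simp only [← hc]

/-- Lower semicontinuity of the norm of `L²(ℓ_q^N)` under convergence of Fourier coefficients. -/
lemma eLpNorm_seqVec_le_of_tendsto_fourierCoeff (hq : 0 < q.toReal) {u : ℕ → ℕ → 𝕋 → ℂ}
    (hu : ∀ n k, Integrable (u n k) μ𝕋) {v : ℕ → 𝕋 → ℂ} (hv : ∀ k, MemLp (v k) 2 μ𝕋)
    {ν : ℕ → ℕ} (hν : Tendsto ν atTop atTop) {c : ℕ → ℝ≥0∞} {C : ℝ≥0∞}
    (hc : Tendsto c atTop (𝓝 C)) (huc : ∀ n, eLpNorm (seqVec q (ν n) (u n)) 2 μ𝕋 ≤ c n)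
    (hlim : ∀ k m, Tendsto (fun n => fourierCoeff (u n k) m) atTop (𝓝 (fourierCoeff (v k) m)))
    (N : ℕ) : eLpNorm (seqVec q N v) 2 μ𝕋 ≤ C := by
  have hvi : ∀ k, Integrable (v k) μ𝕋 := fun k => (hv k).integrable one_le_two
  have hfejer : ∀ M, eLpNorm (seqVec q N fun k => fejerMean M (v k)) 2 μ𝕋 ≤ C := fun M => by
    have hpt : ∀ t, Tendsto (fun n => seqVec q N (fun k => fejerMean M (u n k)) t) atTop
        (𝓝 (seqVec q N (fun k => fejerMean M (v k)) t)) := fun t => by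
      refine ((PiLp.continuous_toLp q _).tendsto _).comp (tendsto_pi_nhds.2 fun k => ?_)
      exact (tendsto_finsetSum _ fun i _ => tendsto_finsetSum _ fun j _ =>
        (hlim k _).const_smul _).const_smul _
    refine (Lp.eLpNorm_lim_le_liminf_eLpNorm (fun n => aestronglyMeasurable_seqVec q N fun k =>
      (continuous_fejerMean M (u n k)).aestronglyMeasurable) _ (ae_of_all _ hpt)).trans ?_
    rw [← hc.liminf_eq]
    refine liminf_le_liminf ?_
    filter_upwards [hν.eventually_ge_atTop N] with n hn
    rw [seqVec_fejerMean M N (hu n)]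
    exact (eLpNorm_fejerMean_le M one_le_two ENNReal.ofNat_ne_top
      (integrable_seqVec N (hu n))).trans
      ((eLpNorm_seqVec_mono two_ne_zero ENNReal.ofNat_ne_top hq hn _).trans (huc n))
  have hbound : ∀ M, eLpNorm (seqVec q N v) 2 μ𝕋 ≤
      C + ∑ k ∈ Finset.range N, eLpNorm (fejerMean M (v k) - v k) 2 μ𝕋 := fun M => by
    have hσ : ∀ k, AEStronglyMeasurable (fejerMean M (v k)) μ𝕋 := fun k =>
      (continuous_fejerMean M (v k)).aestronglyMeasurable
    have hsub : seqVec q N v = seqVec q N (fun k => fejerMean M (v k)) -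
        seqVec q N fun k => fejerMean M (v k) - v k := by
      ext t k
      simp [seqVec]
    rw [hsub]
    refine (eLpNorm_sub_le (aestronglyMeasurable_seqVec q N hσ)
      (aestronglyMeasurable_seqVec q N fun k => (hσ k).sub (hv k).1) one_le_two).trans ?_
    gcongr
    · exact hfejer M
    · exact eLpNorm_seqVec_le_sum one_le_two N fun k => (hσ k).sub (hv k).1
  have htend : Tendsto (fun M => C + ∑ k ∈ Finset.range N, eLpNorm (fejerMean M (v k) - v k) 2 μ𝕋)
      atTop (𝓝 (C + ∑ k ∈ Finset.range N, 0)) :=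
    tendsto_const_nhds.add (tendsto_finsetSum _ fun k _ =>
      fejerConverges_of_memLp one_le_two ENNReal.ofNat_ne_top (hv k))
  rw [Finset.sum_const_zero, add_zero] at htend
  exact ge_of_tendsto' htend hbound

/-- A bounded sequence in `H²(ℓ_q)` whose Fourier coefficients converge has a limit there. -/
lemma exists_memHpLq_of_tendsto_fourierCoeff (hq : 0 < q.toReal) {u : ℕ → ℕ → C(𝕋, ℂ)}
    (hu : ∀ n k, u n k ∈ discAlgebra) {ν : ℕ → ℕ} (hν : Tendsto ν atTop atTop) {c : ℕ → ℝ≥0∞}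
    (hc : Tendsto c atTop (𝓝 1)) (huc : ∀ n, eLpNorm (seqVec q (ν n) fun k => u n k) 2 μ𝕋 ≤ c n)
    {G : ℕ → ℤ → ℂ}
    (hG : ∀ k m, Tendsto (fun n => fourierCoeff (u n k) m) atTop (𝓝 (G k m))) :
    ∃ v : ℕ → 𝕋 → ℂ, (∀ k, MemLp (v k) 2 μ𝕋) ∧ (∀ k m, fourierCoeff (v k) m = G k m) ∧
      MemHpLq 2 q.toReal v ∧ eLpLqNorm 2 q.toReal v ≤ 1 := by
  have hbessel : ∀ k (s : Finset ℤ), ∑ m ∈ s, ‖G k m‖ ^ 2 ≤ 4 := fun k s => by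
    refine le_of_tendsto (tendsto_finsetSum _ fun m _ => (hG k m).norm.pow 2) ?_
    filter_upwards [hν.eventually_gt_atTop k,
      hc.eventually_le_const (by norm_num : (1 : ℝ≥0∞) < 2)] with n hn hcn
    have h2 := ENNReal.toReal_mono ENNReal.ofNat_ne_top
      (((eLpNorm_le_eLpNorm_seqVec hn (fun k => u n k) 2).trans (huc n)).trans hcn)
    rw [ENNReal.toReal_ofNat] at h2
    refine (sum_norm_fourierCoeff_sq_le ((u n k).memLp_circle 2) s).trans ?_
    nlinarith [ENNReal.toReal_nonneg (a := eLpNorm (u n k) 2 μ𝕋)]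
  choose v hv hvG using fun k => exists_memLp_fourierCoeff_eq (hbessel k)
  have hle : eLpLqNorm 2 q.toReal v ≤ 1 := by
    have := eLpLqNorm_le_of_forall (p := 2) two_ne_zero ENNReal.ofNat_ne_top hq (fun k => (hv k).1)
      (eLpNorm_seqVec_le_of_tendsto_fourierCoeff hq (fun n k => (u n k).integrable_circle) hv hν hc
        huc fun k m => by rw [hvG]; exact hG k m)
    rwa [ENNReal.toReal_ofNat] at this
  refine ⟨v, hv, hvG, ⟨⟨fun k => (hv k).1, hle.trans_lt ENNReal.one_lt_top⟩, fun k m hm => ?_⟩, hle⟩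
  rw [hvG]
  exact tendsto_nhds_unique (hG k m) (tendsto_const_nhds.congr fun n => (hu n k m hm).symm)

end Limits

section Main

lemma MemHpLq.integrable {f : ℕ → 𝕋 → ℂ} (hf : MemHpLq 1 (4 / 3) f) (k : ℕ) :
    Integrable (f k) μ𝕋 := by
  have h := eLpNorm_seqVec_le (p := 1) (q := 4 / 3) one_ne_zero ENNReal.one_ne_top
    (by rw [toReal_four_thirds]; norm_num) (k + 1) f
  rw [toReal_four_thirds, ENNReal.toReal_one] at h
  exact memLp_one_iff_integrable.1 ⟨hf.1.1 k,
    (eLpNorm_le_eLpNorm_seqVec k.lt_succ_self f 1).trans_lt (h.trans_lt hf.1.2)⟩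

/-- Factorizations of the Fejér means of `f`. -/
lemma exists_discAlgebra_factorization_fejerMean {f : ℕ → 𝕋 → ℂ} (hf : MemHpLq 1 (4 / 3) f)
    (hf1 : eLpLqNorm 1 (4 / 3) f ≤ 1) (n : ℕ) :
    ∃ g h : ℕ → C(𝕋, ℂ), (∀ k, g k ∈ discAlgebra) ∧ (∀ k, h k ∈ discAlgebra) ∧
      (∀ k < n + 1, ∀ t, fejerMean n (f k) t = g k t * h k t) ∧
      (∀ k, n + 1 ≤ k → g k = 0 ∧ h k = 0) ∧
      eLpNorm (seqVec 2 (n + 1) fun k => g k) 2 μ𝕋 ≤ ENNReal.ofReal (1 + 1 / (n + 1)) ∧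
      eLpNorm (seqVec 4 (n + 1) fun k => h k) 2 μ𝕋 ≤ ENNReal.ofReal (1 + 1 / (n + 1)) := by
  have hle : eLpNorm (seqVec (4 / 3) (n + 1) fun k => fejerMean n (f k)) 1 μ𝕋 ≤ 1 := by
    rw [seqVec_fejerMean n (n + 1) hf.integrable]
    refine (eLpNorm_fejerMean_le n le_rfl ENNReal.one_ne_top
      (integrable_seqVec (n + 1) hf.integrable)).trans ?_
    have h := eLpNorm_seqVec_le (p := 1) (q := 4 / 3) one_ne_zero ENNReal.one_ne_top
      (by rw [toReal_four_thirds]; norm_num) (n + 1) f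
    rw [toReal_four_thirds, ENNReal.toReal_one] at h
    exact h.trans hf1
  obtain ⟨g, h, hg, hh, hgh, h0, hgn, hhn⟩ := exists_discAlgebra_factorization n.succ_pos
    (φ := fun k => ⟨fejerMean n (f k), continuous_fejerMean n (f k)⟩)
    (fun k m hm => by
      rw [ContinuousMap.coe_mk, fourierCoeff_fejerMean, hf.2 k m hm, mul_zero])
    hle (Nat.one_div_pos_of_nat (α := ℝ) (n := n))
  exact ⟨g, h, hg, hh, fun k hk t => DFunLike.congr_fun (hgh k hk) t, h0, hgn, hhn⟩

lemma norm_fourierCoeff_le_of_seqVec {q : ℝ≥0∞} [Fact (1 ≤ q)] {u : ℕ → C(𝕋, ℂ)} {N : ℕ} {c : ℝ}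
    (hc : 0 ≤ c) (hu : eLpNorm (seqVec q N fun k => u k) 2 μ𝕋 ≤ ENNReal.ofReal c)
    (hu0 : ∀ k, N ≤ k → u k = 0) (k : ℕ) (m : ℤ) : ‖fourierCoeff (u k) m‖ ≤ c := by
  have hle : (eLpNorm (u k) 2 μ𝕋).toReal ≤ c := by
    rcases lt_or_ge k N with hk | hk
    · exact ENNReal.toReal_le_of_le_ofReal hc
        ((eLpNorm_le_eLpNorm_seqVec hk (fun k => u k) 2).trans hu)
    · simpa [hu0 k hk] using hc
  have h := sum_norm_fourierCoeff_sq_le ((u k).memLp_circle 2) {m}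
  rw [Finset.sum_singleton] at h
  exact (abs_le_of_sq_le_sq' h ENNReal.toReal_nonneg).2.trans hle

end Main

/-- **Factorization**: every `f = (f_k)` in the unit ball of `H¹(ℓ_{4/3})` factors as
`f_k = g_k · h_k` with `g = (g_k)` in the unit ball of `H²(ℓ₂)` and `h = (h_k)` in the unit
ball of `H²(ℓ₄)`. -/
theorem H1_ell_four_thirds_factorization
    (f : ℕ → 𝕋 → ℂ) (hf : MemHpLq 1 (4 / 3) f) (hf1 : eLpLqNorm 1 (4 / 3) f ≤ 1) :
    ∃ g h : ℕ → 𝕋 → ℂ,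
      MemHpLq 2 2 g ∧ eLpLqNorm 2 2 g ≤ 1 ∧
      MemHpLq 2 4 h ∧ eLpLqNorm 2 4 h ≤ 1 ∧
      ∀ k, ∀ᵐ t ∂μ𝕋, f k t = g k t * h k t := by
  choose g h hg hh hgh h0 hgn hhn using exists_discAlgebra_factorization_fejerMean hf hf1
  have hη : ∀ n : ℕ, 1 + 1 / ((n : ℝ) + 1) ≤ 2 := fun n => by
    have : 1 / ((n : ℝ) + 1) ≤ 1 := by
      rw [div_le_one (by positivity)]
      linarith [n.cast_nonneg (α := ℝ)]
    linarith
  obtain ⟨L, ψ, hψ, hL⟩ := exists_subseq_tendsto (B := 2)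
    (a := fun n (i : ℕ × ℤ) => (fourierCoeff (g n i.1) i.2, fourierCoeff (h n i.1) i.2))
    fun n i => by
      rw [Prod.norm_def]
      exact max_le
        ((norm_fourierCoeff_le_of_seqVec (by positivity) (hgn n) (fun k hk => (h0 n k hk).1)
          i.1 i.2).trans (hη n))
        ((norm_fourierCoeff_le_of_seqVec (by positivity) (hhn n) (fun k hk => (h0 n k hk).2)
          i.1 i.2).trans (hη n))
  have hψ' := hψ.tendsto_atTop
  have hν : Tendsto (fun n => ψ n + 1) atTop atTop := (tendsto_add_atTop_nat 1).comp hψ'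
  have hc : Tendsto (fun n => ENNReal.ofReal (1 + 1 / ((ψ n : ℝ) + 1))) atTop (𝓝 1) := by
    have := ENNReal.tendsto_ofReal
      ((tendsto_one_div_add_atTop_nhds_zero_nat (𝕜 := ℝ)).const_add 1)
    rw [add_zero, ENNReal.ofReal_one] at this
    exact this.comp hψ'
  have hgL : ∀ k m, Tendsto (fun n => fourierCoeff (g (ψ n) k) m) atTop (𝓝 (L (k, m)).1) :=
    fun k m => (continuous_fst.tendsto _).comp (hL (k, m))
  have hhL : ∀ k m, Tendsto (fun n => fourierCoeff (h (ψ n) k) m) atTop (𝓝 (L (k, m)).2) :=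
    fun k m => (continuous_snd.tendsto _).comp (hL (k, m))
  obtain ⟨G, hG2, hGL, hG, hG1⟩ := exists_memHpLq_of_tendsto_fourierCoeff (q := 2) (by norm_num)
    (fun n => hg (ψ n)) hν hc (fun n => hgn (ψ n)) hgL
  obtain ⟨H, hH2, hHL, hH, hH1⟩ := exists_memHpLq_of_tendsto_fourierCoeff (q := 4) (by norm_num)
    (fun n => hh (ψ n)) hν hc (fun n => hhn (ψ n)) hhL
  rw [ENNReal.toReal_ofNat] at hG hG1 hH hH1
  refine ⟨G, H, hG, hG1, hH, hH1, fun k => ae_eq_of_fourierCoeff_eq (hf.integrable k)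
    ((hG2 k).integrable_mul (hH2 k)) fun m => ?_⟩
  have hlim : Tendsto (fun n => fourierCoeff (fejerMean (ψ n) (f k)) m) atTop
      (𝓝 (fourierCoeff (f k) m)) := by
    simp_rw [fourierCoeff_fejerMean]
    have := ((Complex.continuous_ofReal.tendsto _).comp
      ((tendsto_fejerWeight m).comp hψ')).mul_const (fourierCoeff (f k) m)
    rwa [Complex.ofReal_one, one_mul] at this
  refine tendsto_nhds_unique hlim ?_
  rw [fourierCoeff_mul_eq_sum (hG2 k) (hH2 k) (hG.2 k) (hH.2 k) m]
  simp_rw [hGL, hHL]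
  refine (tendsto_finsetSum _ fun j _ => (hgL k j).mul (hhL k (m - j))).congr' ?_
  filter_upwards [hψ'.eventually_ge_atTop k] with n hn
  rw [← fourierCoeff_mul_eq_sum ((g (ψ n) k).memLp_circle 2) ((h (ψ n) k).memLp_circle 2)
    (hg (ψ n) k) (hh (ψ n) k) m]
  congr 1
  exact funext fun t => (hgh (ψ n) k (Nat.lt_succ_of_le hn) t).symm
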